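/- Let R = k[X,Y,Z]/(X^{n+1}-YZ) graded by deg X = 2, deg Y = deg Z = n+1. For each i ∈ {1,…,n}, the Hilbert series of M_i := Syz_R(X^i, Z) is (t^{2i+n+1} + t^{2n+2})/((1-t²)(1-t^{n+1})), and these n Hilbert series are pairwise distinct and none equals the Hilbert series t^l·(1+t^{n+1})/((1-t²)(1-t^{n+1})) of a degree-shifted free module R(-l). -/

import Mathlib

open MvPolynomial

set_option synthInstance.maxHeartbeats 1000000
set_option maxHeartbeats 1000000

noncomputable section

/-- The linear map sending a tuple `s` to `∑ i, s i * g i`. -/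
def syzMap {R : Type*} [CommRing R] {N : ℕ} (g : Fin N → R) : (Fin N → R) →ₗ[R] R where
  toFun s := ∑ i, s i * g i
  map_add' := by intro s t; simp [add_mul, Finset.sum_add_distrib]
  map_smul' := by intro c s; simp [Finset.mul_sum, mul_assoc]

/-- The first syzygy module of `g 0, …, g (N-1)`. -/
def SyzOf {R : Type*} [CommRing R] {N : ℕ} (g : Fin N → R) : Submodule R (Fin N → R) :=
  LinearMap.ker (syzMap g)

/-- The degree-`j` part of the quotient `A/I` of a weighted-graded polynomial ring. -/
def qpiece (k : Type*) [Field k] {ν : ℕ} (w : Fin ν → ℤ) (I : Ideal (MvPolynomial (Fin ν) k))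
    (j : ℤ) : Submodule k (MvPolynomial (Fin ν) k ⧸ I) :=
  Submodule.map (Ideal.Quotient.mkₐ k I).toLinearMap (weightedHomogeneousSubmodule k w j)

/-- The degree-`t` graded piece of the syzygy module `Syz(g) ⊆ ⊕ᵢ (A/I)(-D i)`. -/
def gradedPiece {k : Type*} [Field k] {ν : ℕ} (w : Fin ν → ℤ)
    (I : Ideal (MvPolynomial (Fin ν) k)) {N : ℕ}
    (g : Fin N → MvPolynomial (Fin ν) k ⧸ I) (D : Fin N → ℤ) (t : ℤ) :
    Submodule k (Fin N → MvPolynomial (Fin ν) k ⧸ I) :=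
  (SyzOf g).restrictScalars k ⊓
    ⨅ i, Submodule.comap (LinearMap.proj i) (qpiece k w I (t - D i))

/-- The Hilbert series `H_M(t) = ∑ dim_k(M_j)·t^j ∈ ℚ⟦t⟧` of the graded syzygy module. -/
def hkSeries (k : Type*) [Field k] {ν : ℕ} (w : Fin ν → ℤ)
    (I : Ideal (MvPolynomial (Fin ν) k)) {N : ℕ}
    (g : Fin N → MvPolynomial (Fin ν) k ⧸ I) (D : Fin N → ℤ) : PowerSeries ℚ :=
  PowerSeries.mk fun j : ℕ => (Module.finrank k (gradedPiece w I g D (j : ℤ)) : ℚ)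

/-- The defining ideal of `R = k[X,Y,Z]/(X^{n+1} - YZ)`. -/
def a13Rel (k : Type*) [Field k] (n : ℕ) : Ideal (MvPolynomial (Fin 3) k) :=
  Ideal.span {X 0 ^ (n + 1) - X 1 * X 2}

/-- The Hilbert series of `M_i = Syz_R(X^i, Z)` over `R = k[X,Y,Z]/(X^{n+1}-YZ)`,
graded by `deg X = 2`, `deg Y = deg Z = n+1`. -/
def hs13 (k : Type*) [Field k] (n i : ℕ) : PowerSeries ℚ :=
  hkSeries k ![2, (n : ℤ) + 1, (n : ℤ) + 1] (a13Rel k n)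
    ![Ideal.Quotient.mk (a13Rel k n) (X 0) ^ i, Ideal.Quotient.mk (a13Rel k n) (X 2)]
    ![2 * (i : ℤ), (n : ℤ) + 1]

section PowerSeriesCounting

variable (n : ℕ)

/-- The pairs `(a, b)` of natural numbers with `2 * a + (n + 1) * b + d = t`. -/
def weightPairs (d t : ℕ) : Finset (ℕ × ℕ) :=
  (Finset.range (t + 1) ×ˢ Finset.range (t + 1)).filter
    fun x => 2 * x.1 + (n + 1) * x.2 + d = t

lemma mem_weightPairs {d t : ℕ} {x : ℕ × ℕ} :
    x ∈ weightPairs n d t ↔ 2 * x.1 + (n + 1) * x.2 + d = t := by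
  simp only [weightPairs, Finset.mem_filter, Finset.mem_product, Finset.mem_range,
    and_iff_right_iff_imp]
  intro h
  constructor <;> nlinarith

/-- The geometric series in `X ^ d`. -/
def geomSeries (d : ℕ) : PowerSeries ℚ := PowerSeries.mk fun a => if d ∣ a then 1 else 0

lemma one_sub_X_pow_mul_geomSeries {d : ℕ} (hd : 0 < d) :
    (1 - (PowerSeries.X : PowerSeries ℚ) ^ d) * geomSeries d = 1 := by
  ext a
  rw [sub_mul, one_mul, map_sub, PowerSeries.coeff_X_pow_mul', geomSeries, PowerSeries.coeff_mk,
    PowerSeries.coeff_mk, PowerSeries.coeff_one]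
  by_cases h : d ≤ a
  · have ha : a ≠ 0 := by omega
    simp [h, ha, Nat.dvd_sub_iff_left h dvd_rfl]
  · rcases Nat.eq_zero_or_pos a with rfl | ha
    · simp [h]
    · have : ¬ d ∣ a := fun hda => h (Nat.le_of_dvd ha hda)
      simp [h, this, ha.ne']

lemma mk_card_weightPairs (d : ℕ) :
    PowerSeries.mk (fun t => ((weightPairs n d t).card : ℚ)) =
      PowerSeries.X ^ d * (geomSeries 2 * geomSeries (n + 1)) := by
  ext t
  rw [PowerSeries.coeff_mk, PowerSeries.coeff_X_pow_mul']
  split_ifs with h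
  · simp only [PowerSeries.coeff_mul, geomSeries, PowerSeries.coeff_mk, mul_ite, mul_one, mul_zero,
      ← ite_and]
    rw [Finset.sum_boole]
    norm_cast
    refine Finset.card_bij (fun x _ => (2 * x.1, (n + 1) * x.2)) ?_ ?_ ?_
    · intro x hx
      rw [mem_weightPairs] at hx
      simp only [Finset.mem_filter, Finset.HasAntidiagonal.mem_antidiagonal, dvd_mul_right, and_self, and_true]
      omega
    · rintro ⟨a, b⟩ _ ⟨a', b'⟩ _ hxy
      simpa using hxy
    · rintro ⟨a, b⟩ hx
      simp only [Finset.mem_filter, Finset.HasAntidiagonal.mem_antidiagonal] at hx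
      obtain ⟨hab, ⟨b', rfl⟩, ⟨a', rfl⟩⟩ := hx
      refine ⟨(a', b'), ?_, rfl⟩
      rw [mem_weightPairs]
      dsimp only
      omega
  · rw [Nat.cast_eq_zero, Finset.card_eq_zero, Finset.eq_empty_iff_forall_notMem]
    intro x hx
    rw [mem_weightPairs] at hx
    omega

lemma one_sub_mul_mk_card_weightPairs (d : ℕ) :
    (1 - (PowerSeries.X : PowerSeries ℚ) ^ 2) * (1 - (PowerSeries.X : PowerSeries ℚ) ^ (n + 1)) *
      PowerSeries.mk (fun t => ((weightPairs n d t).card : ℚ)) = PowerSeries.X ^ d := by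
  rw [mk_card_weightPairs]
  linear_combination (PowerSeries.X : PowerSeries ℚ) ^ d *
    ((1 - (PowerSeries.X : PowerSeries ℚ) ^ (n + 1)) * geomSeries (n + 1)) *
      one_sub_X_pow_mul_geomSeries two_pos +
    (PowerSeries.X : PowerSeries ℚ) ^ d * one_sub_X_pow_mul_geomSeries (Nat.add_one_pos n)

end PowerSeriesCounting

section NormalForm

variable (k : Type*) [Field k] (n : ℕ)

/-- The residue class of the monomial `X ^ a * Y ^ b * Z ^ c`. -/
def quotMonomial (a b c : ℕ) : MvPolynomial (Fin 3) k ⧸ a13Rel k n :=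
  Ideal.Quotient.mk _ (X 0 ^ a * X 1 ^ b * X 2 ^ c)

lemma quotMonomial_mul (a b c a' b' c' : ℕ) :
    quotMonomial k n a b c * quotMonomial k n a' b' c' =
      quotMonomial k n (a + a') (b + b') (c + c') := by
  rw [quotMonomial, quotMonomial, quotMonomial, ← map_mul]
  congr 1
  ring

lemma quotMonomial_succ_succ (a b c : ℕ) :
    quotMonomial k n a (b + 1) (c + 1) = quotMonomial k n (a + (n + 1)) b c := by
  refine (Ideal.Quotient.mk_eq_mk_iff_sub_mem _ _).2 (Ideal.mem_span_singleton'.2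
    ⟨-(X 0 ^ a * X 1 ^ b * X 2 ^ c), ?_⟩)
  ring

lemma quotMonomial_add_add (a b c m : ℕ) :
    quotMonomial k n a (b + m) (c + m) = quotMonomial k n (a + (n + 1) * m) b c := by
  induction m generalizing a with
  | zero => rfl
  | succ m ih =>
    rw [← add_assoc, ← add_assoc, quotMonomial_succ_succ, ih]
    congr 1
    ring

lemma quotMonomial_mem_qpiece (a b c : ℕ) {j : ℤ} (h : 2 * a + (n + 1) * b + (n + 1) * c = j) :
    quotMonomial k n a b c ∈ qpiece k ![2, (n : ℤ) + 1, (n : ℤ) + 1] (a13Rel k n) j := by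
  refine ⟨X 0 ^ a * X 1 ^ b * X 2 ^ c, ?_, rfl⟩
  have hX (m : Fin 3) (r : ℕ) := (isWeightedHomogeneous_X k ![2, (n : ℤ) + 1, (n : ℤ) + 1] m).pow r
  have := ((hX 0 a).mul (hX 1 b)).mul (hX 2 c)
  rw [SetLike.mem_coe, mem_weightedHomogeneousSubmodule]
  convert this using 1
  simp [← h]
  ring

/-- The monomials `X ^ a * Y ^ b` and `X ^ a * Z ^ (c + 1)`, which form a basis of the quotient. -/
def normalMonomial : ℕ × ℕ ⊕ ℕ × ℕ → MvPolynomial (Fin 3) k ⧸ a13Rel k n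
  | .inl (a, b) => quotMonomial k n a b 0
  | .inr (a, c) => quotMonomial k n a 0 (c + 1)

/-- The degree of `normalMonomial k n x`. -/
def normalDegree : ℕ × ℕ ⊕ ℕ × ℕ → ℕ
  | .inl (a, b) => 2 * a + (n + 1) * b
  | .inr (a, c) => 2 * a + (n + 1) * (c + 1)

lemma exists_normalMonomial_eq (a b c : ℕ) :
    ∃ x, normalMonomial k n x = quotMonomial k n a b c ∧
      normalDegree n x = 2 * a + (n + 1) * b + (n + 1) * c := by
  rcases le_or_gt c b with h | h
  · obtain ⟨m, rfl⟩ := Nat.exists_eq_add_of_le' h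
    refine ⟨.inl (a + (n + 1) * c, m), ?_, ?_⟩
    · rw [normalMonomial, ← quotMonomial_add_add, zero_add]
    · simp only [normalDegree]; ring
  · obtain ⟨m, rfl⟩ := Nat.exists_eq_add_of_lt h
    refine ⟨.inr (a + (n + 1) * b, m), ?_, ?_⟩
    · rw [normalMonomial, ← quotMonomial_add_add, zero_add]
      congr 1
      ring
    · simp only [normalDegree]; ring

lemma mk_mem_span_normalMonomial (S : Set (ℕ × ℕ ⊕ ℕ × ℕ)) (f : MvPolynomial (Fin 3) k)
    (hf : ∀ d ∈ f.support, ∀ x,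
      normalDegree n x = 2 * d 0 + (n + 1) * d 1 + (n + 1) * d 2 → x ∈ S) :
    Ideal.Quotient.mk (a13Rel k n) f ∈ Submodule.span k (normalMonomial k n '' S) := by
  rw [f.as_sum, map_sum]
  refine Submodule.sum_mem _ fun d hd => ?_
  obtain ⟨x, hx, hdeg⟩ := exists_normalMonomial_eq k n (d 0) (d 1) (d 2)
  have : Ideal.Quotient.mk (a13Rel k n) (monomial d (f.coeff d)) =
      f.coeff d • normalMonomial k n x := by
    rw [hx, quotMonomial, ← Ideal.Quotient.mkₐ_eq_mk k, ← map_smul]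
    congr 1
    rw [monomial_eq, Finsupp.prod_fintype _ _ (by simp), Fin.prod_univ_three, C_mul']
  rw [this]
  exact Submodule.smul_mem _ _ (Submodule.subset_span ⟨x, hf d hd x hdeg, rfl⟩)

lemma mem_span_normalMonomial_of_mem_qpiece {j : ℤ} {r : MvPolynomial (Fin 3) k ⧸ a13Rel k n}
    (hr : r ∈ qpiece k ![2, (n : ℤ) + 1, (n : ℤ) + 1] (a13Rel k n) j) :
    r ∈ Submodule.span k (normalMonomial k n '' {x | (normalDegree n x : ℤ) = j}) := by
  obtain ⟨f, hf, rfl⟩ := hr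
  refine mk_mem_span_normalMonomial k n _ f fun d hd x hx => ?_
  have := hf (mem_support_iff.1 hd)
  simp only [Finsupp.weight_apply, Finsupp.sum_fintype, zero_smul, implies_true,
    Fin.sum_univ_three] at this
  simp only [Set.mem_ofPred_eq, hx, ← this]
  simp
  ring

/-- The embedding `X ↦ u v`, `Y ↦ u ^ (n + 1)`, `Z ↦ v ^ (n + 1)` into the polynomial ring
in `u, v`. -/
def toPlane : (MvPolynomial (Fin 3) k ⧸ a13Rel k n) →ₐ[k] MvPolynomial (Fin 2) k :=
  Ideal.Quotient.liftₐ _ (aeval ![X 0 * X 1, X 0 ^ (n + 1), X 1 ^ (n + 1)]) <| by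
    intro f hf
    obtain ⟨g, rfl⟩ := Ideal.mem_span_singleton'.1 hf
    simp [mul_pow]

/-- The exponent vector of the monomial `u ^ a * v ^ b`. -/
def planeExponent (a b : ℕ) : Fin 2 →₀ ℕ := Finsupp.single 0 a + Finsupp.single 1 b

@[simp] lemma planeExponent_zero (a b : ℕ) : planeExponent a b 0 = a := by simp [planeExponent]

@[simp] lemma planeExponent_one (a b : ℕ) : planeExponent a b 1 = b := by simp [planeExponent]

lemma toPlane_quotMonomial (a b c : ℕ) :
    toPlane k n (quotMonomial k n a b c) =
      monomial (planeExponent (a + (n + 1) * b) (a + (n + 1) * c)) 1 := by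
  rw [monomial_eq, Finsupp.prod_fintype _ _ (by simp), Fin.prod_univ_two, planeExponent_zero,
    planeExponent_one, C_1, one_mul]
  change aeval ![X 0 * X 1, X 0 ^ (n + 1), X 1 ^ (n + 1)] (X 0 ^ a * X 1 ^ b * X 2 ^ c) = _
  simp
  ring

/-- The exponent vector of the image of `normalMonomial k n x` in the polynomial ring. -/
def normalExponent : ℕ × ℕ ⊕ ℕ × ℕ → Fin 2 →₀ ℕ
  | .inl (a, b) => planeExponent (a + (n + 1) * b) a
  | .inr (a, c) => planeExponent a (a + (n + 1) * (c + 1))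

lemma toPlane_normalMonomial (x : ℕ × ℕ ⊕ ℕ × ℕ) :
    toPlane k n (normalMonomial k n x) = monomial (normalExponent n x) 1 := by
  rcases x with ⟨a, b⟩ | ⟨a, c⟩ <;> simp [normalMonomial, normalExponent, toPlane_quotMonomial]

lemma normalExponent_injective : Function.Injective (normalExponent n) := by
  intro x y hxy
  have h0 := DFunLike.congr_fun hxy 0
  have h1 := DFunLike.congr_fun hxy 1
  rcases x with ⟨a, b⟩ | ⟨a, b⟩ <;> rcases y with ⟨a', b'⟩ | ⟨a', b'⟩ <;>
    simp only [normalExponent, planeExponent_zero, planeExponent_one] at h0 h1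
  · subst h1
    simpa using h0
  · nlinarith
  · nlinarith
  · subst h0
    simpa using h1

lemma linearIndependent_toPlane_normalMonomial :
    LinearIndependent k ((toPlane k n).toLinearMap ∘ normalMonomial k n) := by
  have : (toPlane k n).toLinearMap ∘ normalMonomial k n =
      basisMonomials (Fin 2) k ∘ normalExponent n := by
    ext1 x
    simp [toPlane_normalMonomial]
  rw [this]
  exact (basisMonomials (Fin 2) k).linearIndependent.comp _ (normalExponent_injective n)

lemma linearIndependent_normalMonomial : LinearIndependent k (normalMonomial k n) :=
  (linearIndependent_toPlane_normalMonomial k n).of_comp _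

lemma toPlane_injective : Function.Injective (toPlane k n) := by
  rw [injective_iff_map_eq_zero]
  intro r hr
  obtain ⟨f, rfl⟩ := Ideal.Quotient.mk_surjective r
  obtain ⟨c, -, hc⟩ := (Finsupp.mem_span_image_iff_linearCombination k).1
    (mk_mem_span_normalMonomial k n Set.univ f fun _ _ _ _ => trivial)
  rw [← hc] at hr ⊢
  have := linearIndependent_iff.1 (linearIndependent_toPlane_normalMonomial k n) c (by
    rwa [← LinearMap.map_finsupp_linearCombination])
  rw [this, map_zero]

lemma coeff_toPlane_linearCombination (c : ℕ × ℕ ⊕ ℕ × ℕ →₀ k) (x : ℕ × ℕ ⊕ ℕ × ℕ) :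
    (toPlane k n (Finsupp.linearCombination k (normalMonomial k n) c)).coeff
      (normalExponent n x) = c x := by
  classical
  rw [Finsupp.linearCombination_apply, Finsupp.sum, map_sum, coeff_sum]
  simp only [map_smul, toPlane_normalMonomial, coeff_smul, coeff_monomial,
    (normalExponent_injective n).eq_iff]
  simp +contextual [eq_comm]

end NormalForm

section Syzygy

variable (k : Type*) [Field k] (n i : ℕ)

/-- The degree `t` part of the syzygy module of `(X ^ i, Z)`. -/
abbrev syzPiece (t : ℕ) : Submodule k (Fin 2 → MvPolynomial (Fin 3) k ⧸ a13Rel k n) :=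
  gradedPiece ![2, (n : ℤ) + 1, (n : ℤ) + 1] (a13Rel k n)
    ![Ideal.Quotient.mk (a13Rel k n) (X 0) ^ i, Ideal.Quotient.mk (a13Rel k n) (X 2)]
    ![2 * (i : ℤ), (n : ℤ) + 1] t

variable {n i}

lemma mem_syzPiece {t : ℕ} {s : Fin 2 → MvPolynomial (Fin 3) k ⧸ a13Rel k n} :
    s ∈ syzPiece k n i t ↔
      s 0 * quotMonomial k n i 0 0 + s 1 * quotMonomial k n 0 0 1 = 0 ∧
      s 0 ∈ qpiece k ![2, (n : ℤ) + 1, (n : ℤ) + 1] (a13Rel k n) (t - 2 * i) ∧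
      s 1 ∈ qpiece k ![2, (n : ℤ) + 1, (n : ℤ) + 1] (a13Rel k n) (t - (n + 1)) := by
  simp [syzPiece, gradedPiece, SyzOf, syzMap, quotMonomial, Fin.forall_fin_two, Submodule.mem_iInf]

lemma proj_injOn_syzPiece (t : ℕ) :
    Function.Injective ((LinearMap.proj (R := k)
      (φ := fun _ : Fin 2 => MvPolynomial (Fin 3) k ⧸ a13Rel k n) 0).domRestrict
        (syzPiece k n i t)) := by
  rw [injective_iff_map_eq_zero]
  rintro ⟨s, hs⟩ h0
  have h0 : s 0 = 0 := h0
  have h := congrArg (toPlane k n) ((mem_syzPiece k).1 hs).1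
  rw [h0, zero_mul, zero_add, map_mul, map_zero, toPlane_quotMonomial, mul_eq_zero,
    monomial_eq_zero, or_iff_left one_ne_zero, map_eq_zero_iff _ (toPlane_injective k n)] at h
  ext m
  fin_cases m
  · exact h0
  · exact h

/-- The indices of the normal monomials spanning the first coordinates of `syzPiece k n i t`. -/
def syzIndex (n i t : ℕ) : weightPairs n (2 * i + n + 1) t ⊕ weightPairs n (2 * n + 2) t →
    ℕ × ℕ ⊕ ℕ × ℕ
  | .inl x => .inr x
  | .inr x => .inl (x.1.1 + (n + 1 - i), x.1.2)

lemma syzIndex_injective (t : ℕ) : Function.Injective (syzIndex n i t) := by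
  rintro (⟨⟨a, b⟩, _⟩ | ⟨⟨a, b⟩, _⟩) (⟨⟨a', b'⟩, _⟩ | ⟨⟨a', b'⟩, _⟩) h <;>
    simp_all [syzIndex]

lemma normalMonomial_syzIndex_mem (hi : i ≤ n) (t : ℕ)
    (y : weightPairs n (2 * i + n + 1) t ⊕ weightPairs n (2 * n + 2) t) :
    ∃ s ∈ syzPiece k n i t, s 0 = normalMonomial k n (syzIndex n i t y) := by
  obtain ⟨m, rfl⟩ := Nat.exists_eq_add_of_le hi
  rcases y with ⟨⟨a, b⟩, h⟩ | ⟨⟨a, b⟩, h⟩ <;> rw [mem_weightPairs] at h <;> dsimp only at h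
  · refine ⟨![quotMonomial k _ a 0 (b + 1), -quotMonomial k _ (a + i) 0 b],
      (mem_syzPiece k).2 ⟨?_, ?_, ?_⟩, rfl⟩
    · refine (congrArg _ (neg_mul (quotMonomial k _ (a + i) 0 b) _)).trans ?_
      rw [Matrix.cons_val_zero, quotMonomial_mul, quotMonomial_mul, add_neg_eq_zero]
      rfl
    · refine quotMonomial_mem_qpiece k _ _ _ _ ?_
      rw [← h]; push_cast; ring
    · refine neg_mem (quotMonomial_mem_qpiece k _ _ _ _ ?_)
      rw [← h]; push_cast; ring
  · have hm : i + m + 1 - i = m + 1 := by omega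
    refine ⟨![quotMonomial k _ (a + (m + 1)) b 0, -quotMonomial k _ a (b + 1) 0],
      (mem_syzPiece k).2 ⟨?_, ?_, ?_⟩, by simp [syzIndex, hm, normalMonomial]⟩
    · refine (congrArg _ (neg_mul (quotMonomial k _ a (b + 1) 0) _)).trans ?_
      rw [Matrix.cons_val_zero, quotMonomial_mul, quotMonomial_mul, add_neg_eq_zero, quotMonomial_succ_succ]
      congr 1
      ring
    · refine quotMonomial_mem_qpiece k _ _ _ _ ?_
      rw [← h]; push_cast; ring
    · refine neg_mem (quotMonomial_mem_qpiece k _ _ _ _ ?_)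
      rw [← h]; push_cast; ring

lemma mem_span_of_mem_syzPiece (hi : i ≤ n) {t : ℕ}
    {s : Fin 2 → MvPolynomial (Fin 3) k ⧸ a13Rel k n} (hs : s ∈ syzPiece k n i t) :
    s 0 ∈ Submodule.span k (Set.range (normalMonomial k n ∘ syzIndex n i t)) := by
  classical
  obtain ⟨hrel, h0, -⟩ := (mem_syzPiece k).1 hs
  obtain ⟨c, hc, hcs⟩ := (Finsupp.mem_span_image_iff_linearCombination k).1
    (mem_span_normalMonomial_of_mem_qpiece k n h0)
  rw [Set.range_comp]
  refine (Finsupp.mem_span_image_iff_linearCombination k).2 ⟨c, fun x hx => ?_, hcs⟩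
  have hdeg : (normalDegree n x : ℤ) = t - 2 * i := hc hx
  have hexp : n + 1 ≤ normalExponent n x 1 + i := by
    by_contra hlt
    have h := congrArg (fun r => coeff (normalExponent n x + planeExponent i i) (toPlane k n r)) hrel
    simp only [map_add, map_mul, map_zero, toPlane_quotMonomial, coeff_add, ← hcs, mul_zero,
      add_zero, mul_one, zero_add, coeff_mul_monomial, coeff_toPlane_linearCombination,
      coeff_zero] at h
    rw [coeff_mul_monomial', if_neg, add_zero] at h
    · exact Finsupp.mem_support_iff.1 hx h
    · intro hle
      have := hle 1
      simp at this
      omega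
  rcases x with ⟨a, b⟩ | ⟨a, b⟩
  · simp only [normalExponent, planeExponent_one, normalDegree] at hexp hdeg
    refine ⟨.inr ⟨(a - (n + 1 - i), b), ?_⟩, ?_⟩
    · rw [mem_weightPairs]
      dsimp only
      push_cast at hdeg
      zify
      push_cast [show n + 1 - i ≤ a by omega, show i ≤ n + 1 by omega]
      linarith
    · simp only [syzIndex]
      congr 2
      omega
  · simp only [normalDegree] at hdeg
    refine ⟨.inl ⟨(a, b), ?_⟩, rfl⟩
    rw [mem_weightPairs]
    dsimp only
    push_cast at hdeg
    zify
    linarith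

lemma finrank_syzPiece (hi : i ≤ n) (t : ℕ) :
    Module.finrank k (syzPiece k n i t) =
      (weightPairs n (2 * i + n + 1) t).card + (weightPairs n (2 * n + 2) t).card := by
  have hrange : LinearMap.range ((LinearMap.proj (R := k)
      (φ := fun _ : Fin 2 => MvPolynomial (Fin 3) k ⧸ a13Rel k n) 0).domRestrict
        (syzPiece k n i t)) =
      Submodule.span k (Set.range (normalMonomial k n ∘ syzIndex n i t)) := by
    apply le_antisymm
    · rintro _ ⟨⟨s, hs⟩, rfl⟩
      exact mem_span_of_mem_syzPiece k hi hs
    · rw [Submodule.span_le]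
      rintro _ ⟨y, rfl⟩
      obtain ⟨s, hs, h⟩ := normalMonomial_syzIndex_mem k hi t y
      exact ⟨⟨s, hs⟩, h⟩
  rw [← LinearMap.finrank_range_of_inj (proj_injOn_syzPiece k t), hrange,
    finrank_span_eq_card ((linearIndependent_normalMonomial k n).comp _ (syzIndex_injective t))]
  simp

lemma one_sub_mul_hs13 (hi : i ≤ n) :
    (1 - (PowerSeries.X : PowerSeries ℚ) ^ 2) * (1 - (PowerSeries.X : PowerSeries ℚ) ^ (n + 1))
        * hs13 k n i =
      (PowerSeries.X : PowerSeries ℚ) ^ (2 * i + n + 1) +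
        (PowerSeries.X : PowerSeries ℚ) ^ (2 * n + 2) := by
  have : hs13 k n i = PowerSeries.mk (fun t => ((weightPairs n (2 * i + n + 1) t).card : ℚ)) +
      PowerSeries.mk (fun t => ((weightPairs n (2 * n + 2) t).card : ℚ)) := by
    ext t
    rw [map_add, PowerSeries.coeff_mk, PowerSeries.coeff_mk, hs13, hkSeries, PowerSeries.coeff_mk]
    exact_mod_cast finrank_syzPiece k hi t
  rw [this, mul_add, one_sub_mul_mk_card_weightPairs, one_sub_mul_mk_card_weightPairs]

end Syzygy

/-- Over `R = k[X,Y,Z]/(X^{n+1}-YZ)` with `deg X = 2`, `deg Y = deg Z = n+1`, the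
Hilbert series of `M_i := Syz_R(X^i, Z)` (`1 ≤ i ≤ n`) is
`(t^{2i+n+1} + t^{2n+2})/((1-t²)(1-t^{n+1}))`; these `n` Hilbert series are pairwise
distinct, and none equals the Hilbert series `t^l·(1+t^{n+1})/((1-t²)(1-t^{n+1}))`
of a degree-shifted free module `R(-l)`. -/
theorem stmt13 (k : Type*) [Field k] [IsAlgClosed k] (p n : ℕ) (hp : p.Prime) [CharP k p]
    (hp2 : p ≠ 2) (hpn : ¬ p ∣ (n + 1)) :
    (∀ i : ℕ, 1 ≤ i → i ≤ n →
      (1 - (PowerSeries.X : PowerSeries ℚ) ^ 2) * (1 - (PowerSeries.X : PowerSeries ℚ) ^ (n + 1))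
          * hs13 k n i =
        (PowerSeries.X : PowerSeries ℚ) ^ (2 * i + n + 1) +
          (PowerSeries.X : PowerSeries ℚ) ^ (2 * n + 2)) ∧
    (∀ i j : ℕ, 1 ≤ i → i ≤ n → 1 ≤ j → j ≤ n → i ≠ j → hs13 k n i ≠ hs13 k n j) ∧
    (∀ i : ℕ, 1 ≤ i → i ≤ n → ∀ l : ℕ,
      (1 - (PowerSeries.X : PowerSeries ℚ) ^ 2) * (1 - (PowerSeries.X : PowerSeries ℚ) ^ (n + 1))
          * hs13 k n i ≠
        (PowerSeries.X : PowerSeries ℚ) ^ l * (1 + (PowerSeries.X : PowerSeries ℚ) ^ (n + 1))) := by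
  refine ⟨fun i _ hi => one_sub_mul_hs13 k hi, fun i j _ hi _ hj hij h => ?_, fun i h1 hi l h => ?_⟩
  · have h' := one_sub_mul_hs13 k hi
    rw [h, one_sub_mul_hs13 k hj, add_left_inj] at h'
    have := congrArg (PowerSeries.coeff (2 * i + n + 1)) h'
    rw [PowerSeries.coeff_X_pow, PowerSeries.coeff_X_pow_self, if_neg (by omega)] at this
    exact zero_ne_one this
  · rw [one_sub_mul_hs13 k hi, mul_add, mul_one, ← pow_add] at h
    have hc (m : ℕ) := congrArg (PowerSeries.coeff m) h
    simp only [map_add, PowerSeries.coeff_X_pow] at hc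
    have hl := hc l
    have hl' := hc (l + (n + 1))
    split_ifs at hl hl' <;> first | omega | simp at hl hl'
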